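/- arXiv:2510.04407 — 3 statements merged into one kernel-verified Lean document; each statement's English description precedes it below -/
import Mathlib

section
/- Run IREG-PRM⁺ in self-play on the zero-sum game max_{x ∈ Δ(m)} min_{y ∈ Δ(n)} xᵀAy with initialization r̃_𝒳^(1) = 0 and r̃_𝒴^(1) = 0. Then there exists a constant C ≥ 0, independent of T, such that for every T ≥ 1 the average strategy profile (x̄^(T), ȳ^(T)) := ((1/T)Σ_{t=1}^T x^(t), (1/T)Σ_{t=1}^T y^(t)) has duality gap at most C/T, i.e., it is a (C/T)-Nash equilibrium. -/
open Matrix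

/-- ℓ₂ norm of a vector in ℝ^d. -/
noncomputable def l2 {d : ℕ} (v : Fin d → ℝ) : ℝ := Real.sqrt (∑ i, (v i) ^ 2)

/-- ℓ₁ norm of a vector in ℝ^d. -/
def l1 {d : ℕ} (v : Fin d → ℝ) : ℝ := ∑ i, |v i|

/-- Standard inner product on ℝ^d. -/
def dotp {d : ℕ} (v w : Fin d → ℝ) : ℝ := ∑ i, v i * w i

/-- Coordinatewise positive part `[v]⁺`. -/
def ppart {d : ℕ} (v : Fin d → ℝ) : Fin d → ℝ := fun i => max (v i) 0

/-- A run of the IR-PRM⁺ algorithm on the simplex `Δ(n)`, with utilities `u`,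
predictions `m`, regret vectors `rt` (`r̃`) and `r`, normalization constants
`gam` (`γ`), and strategies `x`, `xt` (`x̃`); `g` is the shifted utility
increment.  All quantities are indexed starting from time `1`. -/
structure IRPRMp (n : ℕ) where
  u : ℕ → Fin n → ℝ
  m : ℕ → Fin n → ℝ
  rt : ℕ → Fin n → ℝ
  gam : ℕ → ℝ
  r : ℕ → Fin n → ℝ
  x : ℕ → Fin n → ℝ
  xt : ℕ → Fin n → ℝ
  g : ℕ → Fin n → ℝ
  rt1_nonneg : ∀ i, 0 ≤ rt 1 i
  xt1_mem : rt 1 = 0 → xt 1 ∈ stdSimplex ℝ (Fin n)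
  xt1_eq : rt 1 ≠ 0 → xt 1 = (l1 (rt 1))⁻¹ • rt 1
  zero_case : ∀ t, 1 ≤ t → rt t = 0 →
      m t = 0 ∧ gam t = 0 ∧ r t = 0 ∧ x t = xt t
  gam_spec : ∀ t, 1 ≤ t → rt t ≠ 0 →
      l2 (ppart (rt t + m t - gam t • (1 : Fin n → ℝ))) = l2 (rt t)
  r_def : ∀ t, 1 ≤ t → rt t ≠ 0 →
      r t = rt t + m t - gam t • (1 : Fin n → ℝ)
  x_def : ∀ t, 1 ≤ t → rt t ≠ 0 →
      x t = (l1 (ppart (r t)))⁻¹ • ppart (r t)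
  g_def : ∀ t, 1 ≤ t →
      g t = u t - m t - (dotp (u t - m t) (x t)) • (1 : Fin n → ℝ)
  rt_succ : ∀ t, 1 ≤ t → rt (t + 1) = ppart (r t + g t)
  xt_succ_ne : ∀ t, 1 ≤ t → rt (t + 1) ≠ 0 →
      xt (t + 1) = (l1 (rt (t + 1)))⁻¹ • rt (t + 1)
  xt_succ_zero : ∀ t, 1 ≤ t → rt (t + 1) = 0 → xt (t + 1) = x t

lemma l1_nonneg {d : ℕ} (v : Fin d → ℝ) : 0 ≤ l1 v :=
  Finset.sum_nonneg fun _ _ => abs_nonneg _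

lemma l2_nonneg {d : ℕ} (v : Fin d → ℝ) : 0 ≤ l2 v := Real.sqrt_nonneg _

lemma l2_sq {d : ℕ} (v : Fin d → ℝ) : l2 v ^ 2 = ∑ i, v i ^ 2 :=
  Real.sq_sqrt (Finset.sum_nonneg fun _ _ => sq_nonneg _)

lemma l2_zero {d : ℕ} : l2 (0 : Fin d → ℝ) = 0 := by simp [l2]

lemma l2_pos {d : ℕ} {v : Fin d → ℝ} (hv : v ≠ 0) : 0 < l2 v := by
  obtain ⟨i, hi⟩ := Function.ne_iff.mp hv
  exact Real.sqrt_pos.mpr (Finset.sum_pos' (fun _ _ => sq_nonneg _)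
    ⟨i, Finset.mem_univ _, sq_pos_of_ne_zero hi⟩)

lemma ne_zero_of_l2_pos {d : ℕ} {v : Fin d → ℝ} (hv : 0 < l2 v) : v ≠ 0 := by
  rintro rfl
  exact hv.ne' l2_zero

lemma apply_le_l2 {d : ℕ} (v : Fin d → ℝ) (i : Fin d) : v i ≤ l2 v := by
  refine Real.le_sqrt_of_sq_le ?_
  exact Finset.single_le_sum (f := fun j => v j ^ 2) (fun _ _ => sq_nonneg _) (Finset.mem_univ i)

lemma l2_le_l1 {d : ℕ} (v : Fin d → ℝ) : l2 v ≤ l1 v := by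
  refine Real.sqrt_le_iff.mpr ⟨l1_nonneg v, ?_⟩
  have h := Finset.sum_sq_le_sq_sum_of_nonneg (s := Finset.univ) (f := fun i => |v i|)
    fun i _ => abs_nonneg _
  simpa [l1] using h

lemma l1_pos {d : ℕ} {v : Fin d → ℝ} (hv : v ≠ 0) : 0 < l1 v :=
  (l2_pos hv).trans_le (l2_le_l1 v)

lemma l1_sq_le {d : ℕ} (v : Fin d → ℝ) : l1 v ^ 2 ≤ d * l2 v ^ 2 := by
  have h := sq_sum_le_card_mul_sum_sq (s := Finset.univ) (f := fun i => |v i|)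
  simpa [l1, l2_sq] using h

lemma ppart_nonneg {d : ℕ} (v : Fin d → ℝ) (i : Fin d) : 0 ≤ ppart v i := le_max_right _ _

lemma le_ppart {d : ℕ} (v : Fin d → ℝ) (i : Fin d) : v i ≤ ppart v i := le_max_left _ _

lemma mul_ppart {d : ℕ} (v : Fin d → ℝ) (i : Fin d) : v i * ppart v i = ppart v i ^ 2 := by
  unfold ppart
  rcases max_cases (v i) 0 with h | h <;> rw [h.1] <;> ring

lemma l1_eq_sum {d : ℕ} {v : Fin d → ℝ} (hv : ∀ i, 0 ≤ v i) : l1 v = ∑ i, v i :=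
  Finset.sum_congr rfl fun i _ => abs_of_nonneg (hv i)

lemma normalize_mem {d : ℕ} {v : Fin d → ℝ} (hv : ∀ i, 0 ≤ v i) (h0 : v ≠ 0) :
    (l1 v)⁻¹ • v ∈ stdSimplex ℝ (Fin d) := by
  refine ⟨fun i => mul_nonneg (inv_nonneg.mpr (l1_nonneg v)) (hv i), ?_⟩
  simp only [Pi.smul_apply, smul_eq_mul]
  rw [← Finset.mul_sum, ← l1_eq_sum hv, inv_mul_cancel₀ (l1_pos h0).ne']

lemma l1_normalize_sub_le {d : ℕ} {v w : Fin d → ℝ} (hv : ∀ i, 0 ≤ v i) (hw : ∀ i, 0 ≤ w i)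
    (hv0 : v ≠ 0) (hw0 : w ≠ 0) :
    l1 ((l1 w)⁻¹ • w - (l1 v)⁻¹ • v) ≤ 2 * l1 (w - v) / l1 w := by
  have hV := l1_pos hv0
  have hW := l1_pos hw0
  have hdiff : |l1 v - l1 w| ≤ l1 (w - v) := by
    rw [l1_eq_sum hv, l1_eq_sum hw, ← Finset.sum_sub_distrib]
    refine (Finset.abs_sum_le_sum_abs _ _).trans (le_of_eq ?_)
    exact Finset.sum_congr rfl fun i _ => abs_sub_comm _ _
  have hpt : ∀ i, |((l1 w)⁻¹ • w - (l1 v)⁻¹ • v) i| ≤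
      |(w - v) i| / l1 w + v i * (|l1 v - l1 w| / (l1 w * l1 v)) := by
    intro i
    have : ((l1 w)⁻¹ • w - (l1 v)⁻¹ • v) i =
        (w - v) i / l1 w + v i * ((l1 v - l1 w) / (l1 w * l1 v)) := by
      simp only [Pi.sub_apply, Pi.smul_apply, smul_eq_mul]
      field_simp
      ring
    rw [this]
    refine (abs_add_le _ _).trans (le_of_eq ?_)
    rw [abs_div, abs_mul, abs_div, abs_of_pos hW, abs_of_pos (mul_pos hW hV), abs_of_nonneg (hv i)]
  calc l1 ((l1 w)⁻¹ • w - (l1 v)⁻¹ • v)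
      ≤ ∑ i, (|(w - v) i| / l1 w + v i * (|l1 v - l1 w| / (l1 w * l1 v))) :=
        Finset.sum_le_sum fun i _ => hpt i
    _ = l1 (w - v) / l1 w + l1 v * (|l1 v - l1 w| / (l1 w * l1 v)) := by
        rw [Finset.sum_add_distrib, ← Finset.sum_div, ← Finset.sum_mul, ← l1_eq_sum hv]; rfl
    _ = (l1 (w - v) + |l1 v - l1 w|) / l1 w := by field_simp
    _ ≤ 2 * l1 (w - v) / l1 w := by gcongr; linarith

lemma dotp_le_of_mem_stdSimplex {d : ℕ} {x v : Fin d → ℝ} {B : ℝ}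
    (hx : x ∈ stdSimplex ℝ (Fin d)) (hv : ∀ i, v i ≤ B) : dotp x v ≤ B := by
  calc dotp x v ≤ ∑ i, x i * B :=
        Finset.sum_le_sum fun i _ => mul_le_mul_of_nonneg_left (hv i) (hx.1 i)
    _ = B := by rw [← Finset.sum_mul, hx.2, one_mul]

lemma abs_mulVec_le {m n : ℕ} (A : Matrix (Fin m) (Fin n) ℝ) (z : Fin n → ℝ) (i : Fin m) :
    |(A *ᵥ z) i| ≤ (∑ i, ∑ j, |A i j|) * l1 z := by
  have hA : ∀ j, |A i j| ≤ ∑ i, ∑ j, |A i j| := fun j =>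
    (Finset.single_le_sum (f := fun j => |A i j|) (fun _ _ => abs_nonneg _)
      (Finset.mem_univ j)).trans
    (Finset.single_le_sum (f := fun i => ∑ j, |A i j|)
      (fun _ _ => Finset.sum_nonneg fun _ _ => abs_nonneg _) (Finset.mem_univ i))
  calc |(A *ᵥ z) i| ≤ ∑ j, |A i j * z j| :=
        Finset.abs_sum_le_sum_abs (fun j => A i j * z j) Finset.univ
    _ ≤ ∑ j, (∑ i, ∑ j, |A i j|) * |z j| := by
        refine Finset.sum_le_sum fun j _ => ?_
        rw [abs_mul]
        exact mul_le_mul_of_nonneg_right (hA j) (abs_nonneg _)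
    _ = _ := by rw [← Finset.mul_sum]; rfl

namespace IRPRMp

variable {d : ℕ} (alg : IRPRMp d)

lemma rt_nonneg {t : ℕ} (ht : 1 ≤ t) (i : Fin d) : 0 ≤ alg.rt t i := by
  obtain rfl | ⟨s, hs, rfl⟩ : t = 1 ∨ ∃ s, 1 ≤ s ∧ t = s + 1 := by
    rcases ht.eq_or_lt with h | h
    · exact Or.inl h.symm
    · exact Or.inr ⟨t - 1, by omega, by omega⟩
  · exact alg.rt1_nonneg i
  · rw [alg.rt_succ s hs]
    exact ppart_nonneg _ i

lemma xt_eq {t : ℕ} (ht : 1 ≤ t) (h : alg.rt t ≠ 0) :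
    alg.xt t = (l1 (alg.rt t))⁻¹ • alg.rt t := by
  obtain rfl | ⟨s, hs, rfl⟩ : t = 1 ∨ ∃ s, 1 ≤ s ∧ t = s + 1 := by
    rcases ht.eq_or_lt with h | h
    · exact Or.inl h.symm
    · exact Or.inr ⟨t - 1, by omega, by omega⟩
  · exact alg.xt1_eq h
  · exact alg.xt_succ_ne s hs h

lemma l2_ppart_r {t : ℕ} (ht : 1 ≤ t) : l2 (ppart (alg.r t)) = l2 (alg.rt t) := by
  by_cases h : alg.rt t = 0
  · rw [(alg.zero_case t ht h).2.2.1, h]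
    congr 1
    funext i
    simp [ppart]
  · rw [alg.r_def t ht h, alg.gam_spec t ht h]

lemma ppart_r_ne_zero {t : ℕ} (ht : 1 ≤ t) (h : alg.rt t ≠ 0) : ppart (alg.r t) ≠ 0 :=
  ne_zero_of_l2_pos (by rw [alg.l2_ppart_r ht]; exact l2_pos h)

lemma x_mem_of_ne {t : ℕ} (ht : 1 ≤ t) (h : alg.rt t ≠ 0) :
    alg.x t ∈ stdSimplex ℝ (Fin d) := by
  rw [alg.x_def t ht h]
  exact normalize_mem (ppart_nonneg _) (alg.ppart_r_ne_zero ht h)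

lemma xt_mem {t : ℕ} (ht : 1 ≤ t) : alg.xt t ∈ stdSimplex ℝ (Fin d) := by
  induction t, ht using Nat.le_induction with
  | base =>
    by_cases h : alg.rt 1 = 0
    · exact alg.xt1_mem h
    · rw [alg.xt1_eq h]
      exact normalize_mem (alg.rt_nonneg le_rfl) h
  | succ t ht ih =>
    by_cases h : alg.rt (t + 1) = 0
    · rw [alg.xt_succ_zero t ht h]
      by_cases h' : alg.rt t = 0
      · rw [(alg.zero_case t ht h').2.2.2]
        exact ih
      · exact alg.x_mem_of_ne ht h'
    · rw [alg.xt_succ_ne t ht h]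
      exact normalize_mem (alg.rt_nonneg (by omega)) h

lemma x_mem {t : ℕ} (ht : 1 ≤ t) : alg.x t ∈ stdSimplex ℝ (Fin d) := by
  by_cases h : alg.rt t = 0
  · rw [(alg.zero_case t ht h).2.2.2]
    exact alg.xt_mem ht
  · exact alg.x_mem_of_ne ht h

lemma sum_g_mul_ppart {t : ℕ} (ht : 1 ≤ t) : ∑ i, alg.g t i * ppart (alg.r t) i = 0 := by
  by_cases h : alg.rt t = 0
  · rw [(alg.zero_case t ht h).2.2.1]
    simp [ppart]
  · have hS := l1_pos (alg.ppart_r_ne_zero ht h)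
    have hw : ∀ i, ppart (alg.r t) i = l1 (ppart (alg.r t)) * alg.x t i := by
      intro i
      rw [alg.x_def t ht h]
      simp only [Pi.smul_apply, smul_eq_mul]
      field_simp
    have hgx : ∑ i, alg.g t i * alg.x t i = 0 := by
      rw [alg.g_def t ht]
      simp only [Pi.sub_apply, Pi.smul_apply, Pi.one_apply, smul_eq_mul, mul_one, sub_mul _ (dotp _ _),
        Finset.sum_sub_distrib]
      rw [← Finset.mul_sum, (alg.x_mem ht).2]
      simp [dotp]
    calc ∑ i, alg.g t i * ppart (alg.r t) i
        = ∑ i, l1 (ppart (alg.r t)) * (alg.g t i * alg.x t i) :=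
          Finset.sum_congr rfl fun i _ => by rw [hw i]; ring
      _ = 0 := by rw [← Finset.mul_sum, hgx, mul_zero]

lemma l2_rt_le_succ {t : ℕ} (ht : 1 ≤ t) : l2 (alg.rt t) ≤ l2 (alg.rt (t + 1)) := by
  refine (sq_le_sq₀ (l2_nonneg _) (l2_nonneg _)).mp ?_
  rw [← alg.l2_ppart_r ht, l2_sq, l2_sq, ← sub_nonneg]
  have h : ∑ i, (2 * ppart (alg.r t) i ^ 2 + 2 * (alg.g t i * ppart (alg.r t) i)) ≤
      ∑ i, (alg.rt (t + 1) i ^ 2 + ppart (alg.r t) i ^ 2) := by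
    refine Finset.sum_le_sum fun i _ => ?_
    have h1 : alg.r t i + alg.g t i ≤ alg.rt (t + 1) i := by
      rw [alg.rt_succ t ht]
      exact le_ppart (alg.r t + alg.g t) i
    nlinarith [mul_le_mul_of_nonneg_right h1 (ppart_nonneg (alg.r t) i), mul_ppart (alg.r t) i,
      sq_nonneg (alg.rt (t + 1) i - ppart (alg.r t) i)]
  simp only [Finset.sum_add_distrib, ← Finset.mul_sum, alg.sum_g_mul_ppart ht] at h
  linarith

lemma l2_rt_succ_sq_le {t : ℕ} (ht : 1 ≤ t) :
    l2 (alg.rt (t + 1)) ^ 2 ≤ l2 (alg.rt t) ^ 2 + ∑ i, alg.g t i ^ 2 := by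
  rw [← alg.l2_ppart_r ht, l2_sq, l2_sq]
  have h : ∑ i, alg.rt (t + 1) i ^ 2 ≤
      ∑ i, (ppart (alg.r t) i ^ 2 + 2 * (alg.g t i * ppart (alg.r t) i) + alg.g t i ^ 2) := by
    refine Finset.sum_le_sum fun i _ => ?_
    have h1 : alg.rt (t + 1) i ≤ |ppart (alg.r t) i + alg.g t i| := by
      rw [alg.rt_succ t ht]
      refine max_le ?_ (abs_nonneg _)
      exact (add_le_add_left (le_ppart (alg.r t) i) _).trans (le_abs_self _)
    calc alg.rt (t + 1) i ^ 2 ≤ |ppart (alg.r t) i + alg.g t i| ^ 2 :=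
          pow_le_pow_left₀ (alg.rt_nonneg (by omega) i) h1 2
      _ = _ := by rw [sq_abs]; ring
  simp only [Finset.sum_add_distrib, ← Finset.mul_sum, alg.sum_g_mul_ppart ht] at h
  linarith

lemma l1_x_sub_xt_le {t : ℕ} (ht : 1 ≤ t) (h : alg.rt t ≠ 0) {D : ℝ} (hD : (d : ℝ) ≤ D)
    (hD0 : 0 < D) :
    l2 (alg.rt t) * l1 (alg.x t - alg.xt t) ^ 2 / (8 * D) ≤
      dotp (alg.m t) (alg.x t) - alg.gam t := by
  set w := ppart (alg.r t) with hw
  set v := alg.rt t with hv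
  have hw0 : w ≠ 0 := alg.ppart_r_ne_zero ht h
  have hS := l1_pos hw0
  have hlw : l2 w = l2 v := alg.l2_ppart_r ht
  have hgap : l1 w * (dotp (alg.m t) (alg.x t) - alg.gam t) = l2 (w - v) ^ 2 / 2 := by
    have h1 : ∑ i, v i * w i + ∑ i, alg.m t i * w i - alg.gam t * l1 w = l2 w ^ 2 := by
      rw [l1_eq_sum (ppart_nonneg _), l2_sq, Finset.mul_sum, ← Finset.sum_add_distrib,
        ← Finset.sum_sub_distrib]
      refine Finset.sum_congr rfl fun i _ => ?_
      rw [hw, ← mul_ppart, ← hw]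
      have : alg.r t i = v i + alg.m t i - alg.gam t := by
        rw [alg.r_def t ht h]
        simp [hv]
      rw [this]
      ring
    have h2 : l1 w * dotp (alg.m t) (alg.x t) = ∑ i, alg.m t i * w i := by
      rw [alg.x_def t ht h, ← hw, dotp, Finset.mul_sum]
      refine Finset.sum_congr rfl fun i _ => ?_
      simp only [Pi.smul_apply, smul_eq_mul]
      field_simp
    have h3 : l2 (w - v) ^ 2 = l2 w ^ 2 + l2 v ^ 2 - 2 * ∑ i, v i * w i := by
      simp only [l2_sq, Pi.sub_apply, Finset.mul_sum, ← Finset.sum_add_distrib,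
        ← Finset.sum_sub_distrib]
      exact Finset.sum_congr rfl fun i _ => by ring
    rw [hlw] at h1 h3
    linear_combination h2 + h1 - h3 / 2
  have hp : l1 (alg.x t - alg.xt t) ≤ 2 * l1 (w - v) / l1 w := by
    rw [alg.x_def t ht h, alg.xt_eq ht h]
    exact l1_normalize_sub_le (alg.rt_nonneg ht) (ppart_nonneg _) h hw0
  have hpw : l1 (alg.x t - alg.xt t) * l1 w ≤ 2 * l1 (w - v) := (le_div_iff₀ hS).mp hp
  have hp2 : (l1 (alg.x t - alg.xt t) * l1 w) ^ 2 ≤ 4 * (D * l2 (w - v) ^ 2) := by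
    have h1 := pow_le_pow_left₀ (mul_nonneg (l1_nonneg _) hS.le) hpw 2
    have h2 := l1_sq_le (w - v)
    have h3 := mul_le_mul_of_nonneg_right hD (sq_nonneg (l2 (w - v)))
    nlinarith
  have hR : l2 v ≤ l1 w := hlw ▸ l2_le_l1 w
  have hRp : l1 w * (l2 v * l1 (alg.x t - alg.xt t) ^ 2) ≤
      (l1 (alg.x t - alg.xt t) * l1 w) ^ 2 := by
    nlinarith [mul_le_mul_of_nonneg_right hR
      (mul_nonneg hS.le (sq_nonneg (l1 (alg.x t - alg.xt t))))]
  rw [div_le_iff₀ (by positivity)]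
  refine le_of_mul_le_mul_left ?_ hS
  calc _ ≤ _ := hRp.trans hp2
    _ = (l2 (w - v) ^ 2 / 2) * (8 * D) := by ring
    _ = _ := by rw [← hgap]; ring

lemma rt_add_regret_le {t : ℕ} (ht : 1 ≤ t) {D : ℝ} (hD : (d : ℝ) ≤ D) (hD0 : 0 < D)
    (i : Fin d) :
    alg.rt t i + (alg.u t i - dotp (alg.u t) (alg.x t)) +
      l2 (alg.rt t) * l1 (alg.x t - alg.xt t) ^ 2 / (8 * D) ≤ alg.rt (t + 1) i := by
  have h1 : alg.r t i + alg.g t i ≤ alg.rt (t + 1) i := by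
    rw [alg.rt_succ t ht]
    exact le_ppart (alg.r t + alg.g t) i
  refine le_trans ?_ h1
  have hg : alg.g t i = alg.u t i - alg.m t i -
      (dotp (alg.u t) (alg.x t) - dotp (alg.m t) (alg.x t)) := by
    rw [alg.g_def t ht]
    simp [dotp, sub_mul, Finset.sum_sub_distrib]
  by_cases h : alg.rt t = 0
  · obtain ⟨hm, -, hr, -⟩ := alg.zero_case t ht h
    rw [hg, h, hr, hm, l2_zero]
    simp [dotp]
  · have hr : alg.r t i = alg.rt t i + alg.m t i - alg.gam t := by
      rw [alg.r_def t ht h]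
      simp
    rw [hg, hr]
    linarith [alg.l1_x_sub_xt_le ht h hD hD0]

lemma sum_regret_le {s T : ℕ} (hs : 1 ≤ s) (hsT : s ≤ T) {D : ℝ} (hD : (d : ℝ) ≤ D)
    (hD0 : 0 < D) (i : Fin d) :
    ∑ t ∈ Finset.Ico s T, (alg.u t i - dotp (alg.u t) (alg.x t)) +
      ∑ t ∈ Finset.Ico s T, l2 (alg.rt t) * l1 (alg.x t - alg.xt t) ^ 2 / (8 * D) ≤
      alg.rt T i := by
  induction T, hsT using Nat.le_induction with
  | base => simpa using alg.rt_nonneg hs i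
  | succ T hT ih =>
    rw [Finset.sum_Ico_succ_top hT, Finset.sum_Ico_succ_top hT]
    linarith [alg.rt_add_regret_le (hs.trans hT) hD hD0 i]

lemma sum_g_sq_le {t : ℕ} (ht : 1 ≤ t) {B : ℝ} (hB : ∀ i, |alg.u t i - alg.m t i| ≤ B) :
    ∑ i, alg.g t i ^ 2 ≤ d * (4 * B ^ 2) := by
  have h : ∀ i ∈ Finset.univ, alg.g t i ^ 2 ≤ 4 * B ^ 2 := by
    intro i _
    have h1 : dotp (alg.x t) (alg.u t - alg.m t) ≤ B :=
      dotp_le_of_mem_stdSimplex (alg.x_mem ht) fun i => (abs_le.mp (hB i)).2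
    have h2 : dotp (alg.x t) (-(alg.u t - alg.m t)) ≤ B :=
      dotp_le_of_mem_stdSimplex (alg.x_mem ht) fun i => by
        have := (abs_le.mp (hB i)).1
        simp only [Pi.neg_apply, Pi.sub_apply]
        linarith
    have h3 : dotp (alg.x t) (alg.u t - alg.m t) = dotp (alg.u t - alg.m t) (alg.x t) :=
      Finset.sum_congr rfl fun i _ => mul_comm _ _
    have h4 : dotp (alg.x t) (-(alg.u t - alg.m t)) = -dotp (alg.u t - alg.m t) (alg.x t) := by
      rw [← h3]
      simp only [dotp, Pi.neg_apply, mul_neg, Finset.sum_neg_distrib]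
    have h5 := abs_le.mp (hB i)
    have h6 : |alg.g t i| ≤ 2 * B := by
      rw [alg.g_def t ht]
      simp only [Pi.sub_apply, Pi.smul_apply, Pi.one_apply, smul_eq_mul, mul_one]
      rw [abs_le]
      constructor <;> linarith
    calc alg.g t i ^ 2 = |alg.g t i| ^ 2 := (sq_abs _).symm
      _ ≤ (2 * B) ^ 2 := pow_le_pow_left₀ (abs_nonneg _) h6 2
      _ = _ := by ring
  simpa using Finset.sum_le_card_nsmul _ _ _ h

end IRPRMp

lemma bounded_of_sq_nonincreasing {b : ℕ → ℝ} (hbm : ∀ t, 1 ≤ t → b t ≤ b (t + 1))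
    (hb : ∀ t, 1 ≤ t → 0 < b t → b (t + 1) ^ 2 ≤ b t ^ 2) :
    ∃ B, ∀ t, 1 ≤ t → b t ≤ B := by
  by_cases h : ∃ s, 1 ≤ s ∧ 0 < b s
  · obtain ⟨s, hs, hbs⟩ := h
    have hmono : ∀ t, 1 ≤ t → ∀ u, t ≤ u → b t ≤ b u := by
      intro t ht u hu
      induction u, hu using Nat.le_induction with
      | base => rfl
      | succ u hu ih => exact ih.trans (hbm u (ht.trans hu))
    have htail : ∀ u, s ≤ u → b u ≤ b s := by
      intro u hu
      induction u, hu using Nat.le_induction with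
      | base => rfl
      | succ u hu ih =>
        have hbu := hbs.trans_le (hmono s hs u hu)
        exact ((sq_le_sq₀ (hbu.le.trans (hbm u (hs.trans hu))) hbu.le).mp
          (hb u (hs.trans hu) hbu)).trans ih
    refine ⟨b s, fun t ht => ?_⟩
    rcases le_total s t with h | h
    · exact htail t h
    · exact hmono t ht s h
  · push Not at h
    exact ⟨0, h⟩

/-- Two nondecreasing sequences, each of whose squared increments is controlled by the other's
path length, are bounded as soon as their weighted path lengths are controlled by their sum. -/
lemma bounded_of_coupled_increments {a b p q : ℕ → ℝ} {K c : ℝ} (hK : 0 ≤ K) (hc : 0 < c)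
    (ha1 : a 1 = 0) (hb1 : b 1 = 0)
    (ham : ∀ t, 1 ≤ t → a t ≤ a (t + 1)) (hbm : ∀ t, 1 ≤ t → b t ≤ b (t + 1))
    (ha : ∀ t, 1 ≤ t → 0 < a t → a (t + 1) ^ 2 ≤ a t ^ 2 + K * q t ^ 2)
    (hb : ∀ t, 1 ≤ t → 0 < b t → b (t + 1) ^ 2 ≤ b t ^ 2 + K * p t ^ 2)
    (hp : ∀ t, 1 ≤ t → a t = 0 → p t = 0) (hq : ∀ t, 1 ≤ t → b t = 0 → q t = 0)
    (hsum : ∀ s T, 1 ≤ s → s < T →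
      ∑ t ∈ Finset.Ico s T, (c * (a t * p t ^ 2) + c * (b t * q t ^ 2)) ≤ a T + b T) :
    ∃ B, ∀ t, 1 ≤ t → a t ≤ B ∧ b t ≤ B := by
  have hmono : ∀ f : ℕ → ℝ, (∀ t, 1 ≤ t → f t ≤ f (t + 1)) →
      ∀ t, 1 ≤ t → ∀ u, t ≤ u → f t ≤ f u := by
    intro f hf t ht u hu
    induction u, hu using Nat.le_induction with
    | base => rfl
    | succ u hu ih => exact ih.trans (hf u (ht.trans hu))
  have ham' := hmono a ham
  have hbm' := hmono b hbm
  have ha0 : ∀ t, 1 ≤ t → 0 ≤ a t := fun t ht => ha1 ▸ ham' 1 le_rfl t ht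
  have hb0 : ∀ t, 1 ≤ t → 0 ≤ b t := fun t ht => hb1 ▸ hbm' 1 le_rfl t ht
  by_cases hA : ∃ s, 1 ≤ s ∧ 0 < a s
  swap
  · push Not at hA
    have haz : ∀ t, 1 ≤ t → a t = 0 := fun t ht => le_antisymm (hA t ht) (ha0 t ht)
    obtain ⟨B, hB⟩ := bounded_of_sq_nonincreasing hbm fun t ht h => by
      simpa [hp t ht (haz t ht)] using hb t ht h
    exact ⟨B, fun t ht => ⟨by rw [haz t ht]; exact (hb0 t ht).trans (hB t ht), hB t ht⟩⟩
  by_cases hB : ∃ s, 1 ≤ s ∧ 0 < b s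
  swap
  · push Not at hB
    have hbz : ∀ t, 1 ≤ t → b t = 0 := fun t ht => le_antisymm (hB t ht) (hb0 t ht)
    obtain ⟨B, hB⟩ := bounded_of_sq_nonincreasing ham fun t ht h => by
      simpa [hq t ht (hbz t ht)] using ha t ht h
    exact ⟨B, fun t ht => ⟨hB t ht, by rw [hbz t ht]; exact (ha0 t ht).trans (hB t ht)⟩⟩
  obtain ⟨s₁, hs₁, has₁⟩ := hA
  obtain ⟨s₂, hs₂, hbs₂⟩ := hB
  obtain ⟨s, hs, has, hbs⟩ : ∃ s, 1 ≤ s ∧ 0 < a s ∧ 0 < b s :=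
    ⟨max s₁ s₂, hs₁.trans (le_max_left _ _), has₁.trans_le (ham' _ hs₁ _ (le_max_left _ _)),
      hbs₂.trans_le (hbm' _ hs₂ _ (le_max_right _ _))⟩
  by_cases hL : ∃ r, s ≤ r ∧ K / c ≤ a r * b r
  · obtain ⟨r, hr, hLr⟩ := hL
    have hr1 := hs.trans hr
    have har := has.trans_le (ham' s hs r hr)
    have hbr := hbs.trans_le (hbm' s hs r hr)
    have key : ∀ t, r ≤ t →
        (a (t + 1) - a t) + (b (t + 1) - b t) ≤
          (c * (a t * p t ^ 2) + c * (b t * q t ^ 2)) / 2 := by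
      intro t ht
      have ht1 := hr1.trans ht
      have hat := har.trans_le (ham' r hr1 t ht)
      have hbt := hbr.trans_le (hbm' r hr1 t ht)
      have hKt : K ≤ c * (a t * b t) := by
        have h1 : a r * b r ≤ a t * b t :=
          mul_le_mul (ham' r hr1 t ht) (hbm' r hr1 t ht) hbr.le hat.le
        have h2 := (div_le_iff₀ hc).mp (hLr.trans h1)
        linarith
      have hstep : ∀ {x x' y z : ℝ}, 0 < x → x' ^ 2 ≤ x ^ 2 + K * z ^ 2 → K ≤ c * (x * y) →
          x' - x ≤ c * (y * z ^ 2) / 2 := by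
        intro x x' y z hx h1 h2
        have h3 := mul_le_mul_of_nonneg_right h2 (sq_nonneg z)
        refine le_of_mul_le_mul_left ?_ hx
        nlinarith [sq_nonneg (x' - x)]
      have e1 := hstep hat (ha t ht1 hat) hKt
      have e2 := hstep hbt (hb t ht1 hbt) (by rwa [mul_comm (b t)])
      linarith
    have htail : ∀ T, r ≤ T → a T + b T - (a r + b r) ≤
        (∑ t ∈ Finset.Ico r T, (c * (a t * p t ^ 2) + c * (b t * q t ^ 2))) / 2 := by
      intro T hT
      induction T, hT using Nat.le_induction with
      | base => simp
      | succ T hT ih =>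
        rw [Finset.sum_Ico_succ_top hT]
        linarith [key T hT]
    refine ⟨2 * (a r + b r), fun t ht => ?_⟩
    rcases lt_or_ge r t with h | h
    · have h1 := htail t h.le
      have h2 := hsum r t hr1 h
      constructor <;> linarith [ha0 t ht, hb0 t ht]
    · have h1 := ham' t ht r h
      have h2 := hbm' t ht r h
      constructor <;> linarith
  · push Not at hL
    have hL0 : 0 ≤ K / c := by positivity
    have hbd : ∀ t, s ≤ t → a t ≤ K / c / b s + K / c / a s ∧ b t ≤ K / c / b s + K / c / a s := by
      intro t ht
      have h1 : a t ≤ K / c / b s := by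
        rw [le_div_iff₀ hbs]
        exact (mul_le_mul_of_nonneg_left (hbm' s hs t ht) (ha0 t (hs.trans ht))).trans (hL t ht).le
      have h2 : b t ≤ K / c / a s := by
        rw [le_div_iff₀ has, mul_comm]
        exact (mul_le_mul_of_nonneg_right (ham' s hs t ht) (hb0 t (hs.trans ht))).trans
          (hL t ht).le
      have h3 : 0 ≤ K / c / b s := by positivity
      have h4 : 0 ≤ K / c / a s := by positivity
      constructor <;> linarith
    refine ⟨K / c / b s + K / c / a s, fun t ht => ?_⟩
    rcases le_total s t with h | h
    · exact hbd t h
    · exact ⟨(ham' t ht s h).trans (hbd s le_rfl).1, (hbm' t ht s h).trans (hbd s le_rfl).2⟩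

lemma average_mem_stdSimplex {d : ℕ} {x : ℕ → Fin d → ℝ} {s T : ℕ} (hsT : s < T)
    (hx : ∀ t, s ≤ t → x t ∈ stdSimplex ℝ (Fin d)) :
    ((T : ℝ) - s)⁻¹ • ∑ t ∈ Finset.Ico s T, x t ∈ stdSimplex ℝ (Fin d) := by
  have hpos : (0 : ℝ) < (T : ℝ) - s := sub_pos.mpr (by exact_mod_cast hsT)
  have hmem : ∀ t ∈ Finset.Ico s T, x t ∈ stdSimplex ℝ (Fin d) := fun t ht =>
    hx t (Finset.mem_Ico.mp ht).1
  have h := (convex_stdSimplex ℝ (Fin d)).sum_mem (t := Finset.Ico s T)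
    (w := fun _ => ((T : ℝ) - s)⁻¹) (z := x) (fun _ _ => inv_nonneg.mpr hpos.le)
    (by simp [Nat.cast_sub hsT.le, hpos.ne']) hmem
  rwa [← Finset.smul_sum] at h

lemma dotp_mulVec {m n : ℕ} (A : Matrix (Fin m) (Fin n) ℝ) (x : Fin m → ℝ) (y : Fin n → ℝ) :
    dotp x (A *ᵥ y) = dotp (Aᵀ *ᵥ x) y := by
  change x ⬝ᵥ A *ᵥ y = (Aᵀ *ᵥ x) ⬝ᵥ y
  rw [Matrix.dotProduct_mulVec, Matrix.mulVec_transpose]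

lemma dotp_comm {d : ℕ} (v w : Fin d → ℝ) : dotp v w = dotp w v :=
  Finset.sum_congr rfl fun _ _ => mul_comm _ _

lemma dotp_neg {d : ℕ} (v w : Fin d → ℝ) : dotp v (-w) = -dotp v w := by
  simp [dotp]

lemma dotp_smul {d : ℕ} (k : ℝ) (v w : Fin d → ℝ) : dotp v (k • w) = k * dotp v w := by
  simp only [dotp, Pi.smul_apply, smul_eq_mul, Finset.mul_sum]
  exact Finset.sum_congr rfl fun _ _ => by ring

/-- The cumulative gap over the window `[s, T)`, plus the path-length terms, is at most the sum of
the norms of the final regret vectors. -/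
lemma window_gap_le {m n : ℕ} (A : Matrix (Fin m) (Fin n) ℝ)
    (algX : IRPRMp m) (algY : IRPRMp n)
    (huX : ∀ t, 1 ≤ t → algX.u t = A *ᵥ algY.x t)
    (huY : ∀ t, 1 ≤ t → algY.u t = -(Aᵀ *ᵥ algX.x t))
    {D : ℝ} (hmD : (m : ℝ) ≤ D) (hnD : (n : ℝ) ≤ D) (hD0 : 0 < D)
    {s T : ℕ} (hs : 1 ≤ s) (hsT : s ≤ T) {x : Fin m → ℝ} {y : Fin n → ℝ}
    (hx : x ∈ stdSimplex ℝ (Fin m)) (hy : y ∈ stdSimplex ℝ (Fin n)) :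
    dotp x (A *ᵥ ∑ t ∈ Finset.Ico s T, algY.x t) - dotp (Aᵀ *ᵥ ∑ t ∈ Finset.Ico s T, algX.x t) y +
      (∑ t ∈ Finset.Ico s T, l2 (algX.rt t) * l1 (algX.x t - algX.xt t) ^ 2 / (8 * D) +
        ∑ t ∈ Finset.Ico s T, l2 (algY.rt t) * l1 (algY.x t - algY.xt t) ^ 2 / (8 * D)) ≤
      l2 (algX.rt T) + l2 (algY.rt T) := by
  set V := ∑ t ∈ Finset.Ico s T, dotp (algX.x t) (A *ᵥ algY.x t) with hV
  have hX : dotp x (A *ᵥ ∑ t ∈ Finset.Ico s T, algY.x t) ≤ l2 (algX.rt T) + V -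
      ∑ t ∈ Finset.Ico s T, l2 (algX.rt t) * l1 (algX.x t - algX.xt t) ^ 2 / (8 * D) := by
    refine dotp_le_of_mem_stdSimplex hx fun i => ?_
    have h1 := (algX.sum_regret_le hs hsT hmD hD0 i).trans (apply_le_l2 _ i)
    have h2 : ∑ t ∈ Finset.Ico s T, (algX.u t i - dotp (algX.u t) (algX.x t)) =
        (A *ᵥ ∑ t ∈ Finset.Ico s T, algY.x t) i - V := by
      rw [Matrix.mulVec_sum, Finset.sum_apply, hV, ← Finset.sum_sub_distrib]
      refine Finset.sum_congr rfl fun t ht => ?_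
      rw [huX t (hs.trans (Finset.mem_Ico.mp ht).1), dotp_comm]
    linarith
  have hY : dotp y (-(Aᵀ *ᵥ ∑ t ∈ Finset.Ico s T, algX.x t)) ≤ l2 (algY.rt T) - V -
      ∑ t ∈ Finset.Ico s T, l2 (algY.rt t) * l1 (algY.x t - algY.xt t) ^ 2 / (8 * D) := by
    refine dotp_le_of_mem_stdSimplex hy fun j => ?_
    have h1 := (algY.sum_regret_le hs hsT hnD hD0 j).trans (apply_le_l2 _ j)
    have h2 : ∑ t ∈ Finset.Ico s T, (algY.u t j - dotp (algY.u t) (algY.x t)) =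
        (-(Aᵀ *ᵥ ∑ t ∈ Finset.Ico s T, algX.x t)) j + V := by
      rw [Matrix.mulVec_sum, Pi.neg_apply, Finset.sum_apply, hV, ← Finset.sum_neg_distrib,
        ← Finset.sum_add_distrib]
      refine Finset.sum_congr rfl fun t ht => ?_
      rw [huY t (hs.trans (Finset.mem_Ico.mp ht).1), dotp_mulVec, dotp_comm (-_), dotp_neg,
        dotp_comm (algY.x t), Pi.neg_apply, sub_neg_eq_add]
    linarith
  rw [dotp_neg, dotp_comm y] at hY
  linarith

/-- The regret vectors of both players stay bounded. -/
lemma regret_norms_bounded {m n : ℕ} (A : Matrix (Fin m) (Fin n) ℝ)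
    (algX : IRPRMp m) (algY : IRPRMp n)
    (hmX : ∀ t, 1 ≤ t → algX.rt t ≠ 0 → algX.m t = A *ᵥ algY.xt t)
    (hmY : ∀ t, 1 ≤ t → algY.rt t ≠ 0 → algY.m t = -(Aᵀ *ᵥ algX.xt t))
    (huX : ∀ t, 1 ≤ t → algX.u t = A *ᵥ algY.x t)
    (huY : ∀ t, 1 ≤ t → algY.u t = -(Aᵀ *ᵥ algX.x t))
    (hinitX : algX.rt 1 = 0) (hinitY : algY.rt 1 = 0)
    {D : ℝ} (hmD : (m : ℝ) ≤ D) (hnD : (n : ℝ) ≤ D) (hD0 : 0 < D) :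
    ∃ B, ∀ t, 1 ≤ t → l2 (algX.rt t) ≤ B ∧ l2 (algY.rt t) ≤ B := by
  set M := ∑ i, ∑ j, |A i j| with hM
  have hMT : ∑ j, ∑ i, |Aᵀ j i| = M := Finset.sum_comm
  have hfix : ∀ {d : ℕ} (alg : IRPRMp d) (t : ℕ), 1 ≤ t → l2 (alg.rt t) = 0 →
      l1 (alg.x t - alg.xt t) = 0 := by
    intro d alg t ht h
    have h0 : alg.rt t = 0 := by
      by_contra h'
      exact (l2_pos h').ne' h
    rw [(alg.zero_case t ht h0).2.2.2]
    simp [l1]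
  have hgrow : ∀ {d : ℕ} (alg : IRPRMp d) (t : ℕ) (q : ℝ), (d : ℝ) ≤ D → 1 ≤ t →
      (∀ i, |alg.u t i - alg.m t i| ≤ M * q) →
      l2 (alg.rt (t + 1)) ^ 2 ≤ l2 (alg.rt t) ^ 2 + D * (4 * M ^ 2) * q ^ 2 := by
    intro d alg t q hd ht h
    have h1 := alg.l2_rt_succ_sq_le ht
    have h2 := alg.sum_g_sq_le ht h
    have h3 := mul_le_mul_of_nonneg_right hd (by positivity : 0 ≤ 4 * (M * q) ^ 2)
    have h4 : D * (4 * M ^ 2) * q ^ 2 = D * (4 * (M * q) ^ 2) := by ring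
    linarith
  refine bounded_of_coupled_increments (p := fun t => l1 (algX.x t - algX.xt t))
    (q := fun t => l1 (algY.x t - algY.xt t)) (K := D * (4 * M ^ 2)) (c := (8 * D)⁻¹)
    (by positivity) (by positivity) (by rw [hinitX, l2_zero]) (by rw [hinitY, l2_zero])
    (fun t => algX.l2_rt_le_succ) (fun t => algY.l2_rt_le_succ) ?_ ?_
    (hfix algX) (hfix algY) ?_
  · intro t ht h
    refine hgrow algX t _ hmD ht fun i => ?_
    rw [hmX t ht (ne_zero_of_l2_pos h), huX t ht, ← Pi.sub_apply, ← Matrix.mulVec_sub]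
    exact abs_mulVec_le A _ i
  · intro t ht h
    refine hgrow algY t _ hnD ht fun j => ?_
    rw [hmY t ht (ne_zero_of_l2_pos h), huY t ht, ← Pi.sub_apply, neg_sub_neg,
      ← neg_sub (Aᵀ *ᵥ algX.x t), ← Matrix.mulVec_sub, Pi.neg_apply, abs_neg, ← hMT]
    exact abs_mulVec_le Aᵀ _ j
  · intro s T hs hsT
    have hx := average_mem_stdSimplex hsT fun t ht => algX.x_mem (hs.trans ht)
    have hy := average_mem_stdSimplex hsT fun t ht => algY.x_mem (hs.trans ht)
    have h := window_gap_le A algX algY huX huY hmD hnD hD0 hs hsT.le hx hy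
    rw [dotp_comm, dotp_smul, dotp_comm, dotp_mulVec, dotp_smul, sub_self, zero_add,
      ← Finset.sum_add_distrib] at h
    refine le_trans (le_of_eq (Finset.sum_congr rfl fun t _ => ?_)) h
    ring

/-- for IREG-PRM⁺ in self-play on a zero-sum game, initialized at
`r̃_X^(1) = 0`, `r̃_Y^(1) = 0`, the average strategies form a `(C/T)`-Nash
equilibrium for a constant `C` independent of `T`. -/
theorem stmt14
    {m n : ℕ} (A : Matrix (Fin m) (Fin n) ℝ)
    (algX : IRPRMp m) (algY : IRPRMp n)
    -- extragradient predictions and utilities (IREG-PRM⁺ self-play coupling)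
    (hmX : ∀ t, 1 ≤ t → algX.rt t ≠ 0 → algX.m t = A *ᵥ algY.xt t)
    (hmY : ∀ t, 1 ≤ t → algY.rt t ≠ 0 → algY.m t = -(Aᵀ *ᵥ algX.xt t))
    (huX : ∀ t, 1 ≤ t → algX.u t = A *ᵥ algY.x t)
    (huY : ∀ t, 1 ≤ t → algY.u t = -(Aᵀ *ᵥ algX.x t))
    (hinitX : algX.rt 1 = 0) (hinitY : algY.rt 1 = 0) :
    ∃ C : ℝ, 0 ≤ C ∧ ∀ T : ℕ, 1 ≤ T →
      sSup ((fun xs : Fin m → ℝ =>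
          dotp xs (A *ᵥ ((T : ℝ)⁻¹ • ∑ t ∈ Finset.Icc 1 T, algY.x t)))
          '' stdSimplex ℝ (Fin m))
        - sInf ((fun ys : Fin n → ℝ =>
          dotp (Aᵀ *ᵥ ((T : ℝ)⁻¹ • ∑ t ∈ Finset.Icc 1 T, algX.x t)) ys)
          '' stdSimplex ℝ (Fin n))
        ≤ C / (T : ℝ) := by
  obtain ⟨B, hB⟩ := regret_norms_bounded A algX algY hmX hmY huX huY hinitX hinitY
    (D := (m : ℝ) + n + 1) (by linarith [n.cast_nonneg (α := ℝ)])
    (by linarith [m.cast_nonneg (α := ℝ)]) (by positivity)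
  have hB0 : 0 ≤ B := (l2_nonneg _).trans (hB 1 le_rfl).1
  refine ⟨2 * B, by positivity, fun T hT => ?_⟩
  have hT0 : (0 : ℝ) < T := by exact_mod_cast hT
  have hIcc : Finset.Icc 1 T = Finset.Ico 1 (T + 1) := by
    ext t
    simp
  have hgap : ∀ x ∈ stdSimplex ℝ (Fin m), ∀ y ∈ stdSimplex ℝ (Fin n),
      dotp x (A *ᵥ ((T : ℝ)⁻¹ • ∑ t ∈ Finset.Icc 1 T, algY.x t)) -
        dotp (Aᵀ *ᵥ ((T : ℝ)⁻¹ • ∑ t ∈ Finset.Icc 1 T, algX.x t)) y ≤ 2 * B / T := by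
    intro x hx y hy
    have h := window_gap_le A algX algY huX huY (D := (m : ℝ) + n + 1)
      (by linarith [n.cast_nonneg (α := ℝ)]) (by linarith [m.cast_nonneg (α := ℝ)])
      (by positivity) le_rfl (show 1 ≤ T + 1 by omega) hx hy
    have hN : ∀ {d : ℕ} (alg : IRPRMp d), 0 ≤ ∑ t ∈ Finset.Ico 1 (T + 1),
        l2 (alg.rt t) * l1 (alg.x t - alg.xt t) ^ 2 / (8 * ((m : ℝ) + n + 1)) := fun alg =>
      Finset.sum_nonneg fun t _ =>
        div_nonneg (mul_nonneg (l2_nonneg _) (sq_nonneg _)) (by positivity)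
    have hb := hB (T + 1) (by omega)
    rw [hIcc, Matrix.mulVec_smul, Matrix.mulVec_smul, dotp_smul, dotp_comm (_ • _), dotp_smul,
      dotp_comm y, ← mul_sub, inv_mul_eq_div]
    refine div_le_div_of_nonneg_right ?_ hT0.le
    linarith [hN algX, hN algY]
  have hneX : (stdSimplex ℝ (Fin m)).Nonempty := ⟨_, algX.x_mem le_rfl⟩
  have hneY : (stdSimplex ℝ (Fin n)).Nonempty := ⟨_, algY.x_mem le_rfl⟩
  rw [sub_le_iff_le_add]
  refine csSup_le (hneX.image _) ?_
  rintro _ ⟨x, hx, rfl⟩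
  rw [← sub_le_iff_le_add']
  refine le_csInf (hneY.image _) ?_
  rintro _ ⟨y, hy, rfl⟩
  have := hgap x hx y hy
  simp only
  linarith
end

section
/- Let v ∈ ℝⁿ with n ≥ 1 and let t > 0. Define f(γ) := ‖[v − γ1]⁺‖₂ for γ ∈ ℝ. Then f is strictly decreasing on (−∞, max_i v_i), f(γ) = 0 for all γ ≥ max_i v_i, and there exists a unique γ ∈ ℝ with f(γ) = t; moreover this γ satisfies γ < max_i v_i. -/
theorem l2_ppart_sub_smul_one {n : ℕ} (v : Fin n → ℝ) (γ : ℝ) :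
    l2 (ppart (v - γ • (1 : Fin n → ℝ))) = √(∑ i, (max (v i - γ) 0) ^ 2) := by
  simp [l2, ppart]

theorem continuous_l2_ppart_sub_smul_one {n : ℕ} (v : Fin n → ℝ) :
    Continuous fun γ : ℝ => l2 (ppart (v - γ • (1 : Fin n → ℝ))) := by
  simp only [l2_ppart_sub_smul_one]
  fun_prop

theorem l2_ppart_sub_smul_one_eq_zero {n : ℕ} (v : Fin n → ℝ) {γ : ℝ} (h : ∀ i, v i ≤ γ) :
    l2 (ppart (v - γ • (1 : Fin n → ℝ))) = 0 := by
  rw [l2_ppart_sub_smul_one, Finset.sum_eq_zero, Real.sqrt_zero]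
  intro i _
  simp [max_eq_right (sub_nonpos.2 (h i))]

theorem l2_ppart_sub_smul_one_lt {n : ℕ} (v : Fin n → ℝ) {a b : ℝ} (hab : a < b) {j : Fin n}
    (hj : b < v j) :
    l2 (ppart (v - b • (1 : Fin n → ℝ))) < l2 (ppart (v - a • (1 : Fin n → ℝ))) := by
  rw [l2_ppart_sub_smul_one, l2_ppart_sub_smul_one]
  refine Real.sqrt_lt_sqrt (by positivity)
    (Finset.sum_lt_sum (fun i _ => ?_) ⟨j, Finset.mem_univ j, ?_⟩)
  · gcongr
  · rw [max_eq_left (by linarith), max_eq_left (by linarith)]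
    exact pow_lt_pow_left₀ (by linarith) (by linarith) two_ne_zero

theorem sub_le_l2_ppart_sub_smul_one {n : ℕ} (v : Fin n → ℝ) (γ : ℝ) (j : Fin n) :
    v j - γ ≤ l2 (ppart (v - γ • (1 : Fin n → ℝ))) := by
  rw [l2_ppart_sub_smul_one]
  refine (le_max_left _ 0).trans (Real.le_sqrt_of_sq_le ?_)
  exact Finset.single_le_sum (f := fun i => (max (v i - γ) 0) ^ 2)
    (fun i _ => sq_nonneg _) (Finset.mem_univ j)

/-- `f(γ) = ‖[v - γ1]⁺‖₂` is strictly decreasing on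
`(-∞, max_i v_i)`, vanishes for `γ ≥ max_i v_i`, and for every `t > 0` the
equation `f(γ) = t` has a unique solution, which moreover lies below
`max_i v_i`. -/
theorem stmt16 {n : ℕ} (hn : 1 ≤ n) (v : Fin n → ℝ) (t : ℝ) (ht : 0 < t) :
    StrictAntiOn (fun γ : ℝ => l2 (ppart (v - γ • (1 : Fin n → ℝ))))
        (Set.Iio (⨆ i, v i))
    ∧ (∀ γ : ℝ, (⨆ i, v i) ≤ γ → l2 (ppart (v - γ • (1 : Fin n → ℝ))) = 0)
    ∧ (∃! γ : ℝ, l2 (ppart (v - γ • (1 : Fin n → ℝ))) = t)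
    ∧ ∀ γ : ℝ, l2 (ppart (v - γ • (1 : Fin n → ℝ))) = t → γ < ⨆ i, v i := by
  have : Nonempty (Fin n) := ⟨⟨0, hn⟩⟩
  obtain ⟨j, hj⟩ := exists_eq_ciSup_of_finite (f := v)
  have hle : ∀ i, v i ≤ ⨆ i, v i := le_ciSup (Set.finite_range v).bddAbove
  have hanti : StrictAntiOn (fun γ : ℝ => l2 (ppart (v - γ • (1 : Fin n → ℝ))))
      (Set.Iio (⨆ i, v i)) := fun a _ b hb hab =>
    l2_ppart_sub_smul_one_lt v hab (hb.trans_eq hj.symm)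
  have hzero : ∀ γ : ℝ, (⨆ i, v i) ≤ γ → l2 (ppart (v - γ • (1 : Fin n → ℝ))) = 0 :=
    fun γ hγ => l2_ppart_sub_smul_one_eq_zero v fun i => (hle i).trans hγ
  have hlt : ∀ γ : ℝ, l2 (ppart (v - γ • (1 : Fin n → ℝ))) = t → γ < ⨆ i, v i := by
    intro γ hγ
    by_contra! h
    exact ht.ne' (hγ.symm.trans (hzero γ h))
  refine ⟨hanti, hzero, ?_, hlt⟩
  have hlow := sub_le_l2_ppart_sub_smul_one v (v j - t) j
  rw [sub_sub_cancel] at hlow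
  obtain ⟨γ, -, hγ⟩ := intermediate_value_Icc' (sub_le_self (v j) ht.le)
    (continuous_l2_ppart_sub_smul_one v).continuousOn
    ⟨(hzero (v j) hj.ge).trans_le ht.le, hlow⟩
  exact ⟨γ, hγ, fun γ' hγ' => hanti.injOn (hlt γ' hγ') (hlt γ hγ) (hγ'.trans hγ.symm)⟩
end

section
/- Let v ∈ ℝⁿ, t > 0, and let γ ∈ ℝ satisfy ‖[v − γ1]⁺‖₂ = t. Let k := |{i : v_i > γ}|, s := Σ_{i : v_i > γ} v_i, and s₂ := Σ_{i : v_i > γ} v_i². Then k ≥ 1, the discriminant satisfies s² − k(s₂ − t²) ≥ 0, and γ = (1/k)(s − √(s² − k(s₂ − t²))), i.e., γ is the smaller root of the quadratic k γ² − 2 s γ + (s₂ − t²) = 0. -/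
/-- The squared `ℓ₂` norm of `[v - γ1]⁺`, expanded over the coordinates exceeding `γ`. -/
theorem l2_ppart_sub_smul_one_sq {n : ℕ} (v : Fin n → ℝ) (γ : ℝ) :
    l2 (ppart (v - γ • (1 : Fin n → ℝ))) ^ 2 =
      ∑ i ∈ Finset.univ.filter (fun i => γ < v i), (v i - γ) ^ 2 := by
  rw [l2, Real.sq_sqrt (Finset.sum_nonneg fun i _ => sq_nonneg _), Finset.sum_filter]
  refine Finset.sum_congr rfl fun i _ => ?_
  simp only [ppart, Pi.sub_apply, Pi.smul_apply, Pi.one_apply, smul_eq_mul, mul_one]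
  split_ifs with h
  · rw [max_eq_left (by linarith)]
  · rw [max_eq_right (by linarith)]
    norm_num

/-- if `‖[v - γ1]⁺‖₂ = t` with `t > 0`, then with
`k = |{i : v_i > γ}|`, `s = ∑_{v_i > γ} v_i` and `s₂ = ∑_{v_i > γ} v_i²`, we
have `k ≥ 1`, the discriminant `s² - k(s₂ - t²)` is nonnegative, and `γ` is the
smaller root of `k γ² - 2 s γ + (s₂ - t²) = 0`, i.e.
`γ = (1/k)(s - √(s² - k(s₂ - t²)))`. -/
theorem stmt17 {n : ℕ} (v : Fin n → ℝ) (t : ℝ) (ht : 0 < t) (γ : ℝ)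
    (hγ : l2 (ppart (v - γ • (1 : Fin n → ℝ))) = t)
    (k : ℕ) (hk : k = (Finset.univ.filter (fun i => γ < v i)).card)
    (s s2 : ℝ)
    (hs : s = ∑ i ∈ Finset.univ.filter (fun i => γ < v i), v i)
    (hs2 : s2 = ∑ i ∈ Finset.univ.filter (fun i => γ < v i), (v i) ^ 2) :
    1 ≤ k
    ∧ 0 ≤ s ^ 2 - (k : ℝ) * (s2 - t ^ 2)
    ∧ γ = (1 / (k : ℝ)) * (s - Real.sqrt (s ^ 2 - (k : ℝ) * (s2 - t ^ 2))) := by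
  have hsq := l2_ppart_sub_smul_one_sq v γ
  rw [hγ] at hsq
  have hk1 : 1 ≤ k := by
    rw [hk, Nat.one_le_iff_ne_zero, Finset.card_ne_zero]
    by_contra hne
    rw [Finset.not_nonempty_iff_eq_empty.mp hne, Finset.sum_empty] at hsq
    exact (pow_pos ht 2).ne' hsq
  have hquad : t ^ 2 = s2 - 2 * γ * s + k * γ ^ 2 := by
    rw [hsq, hs, hs2, hk, Finset.mul_sum, ← nsmul_eq_mul, ← Finset.sum_const,
      ← Finset.sum_sub_distrib, ← Finset.sum_add_distrib]
    exact Finset.sum_congr rfl fun i _ => by ring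
  have hle : 0 ≤ s - k * γ := by
    rw [hs, hk, ← nsmul_eq_mul, ← Finset.sum_const, ← Finset.sum_sub_distrib]
    exact Finset.sum_nonneg fun i hi => sub_nonneg.mpr (Finset.mem_filter.mp hi).2.le
  have hdisc : s ^ 2 - (k : ℝ) * (s2 - t ^ 2) = (s - k * γ) ^ 2 := by
    rw [hquad]
    ring
  have hk0 : (k : ℝ) ≠ 0 := Nat.cast_ne_zero.mpr (by omega)
  refine ⟨hk1, hdisc ▸ sq_nonneg _, ?_⟩
  rw [hdisc, Real.sqrt_sq hle]
  field_simp
  ring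
end
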